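/- Given an influence network G(W) on node set V, the following two statements are equivalent: (2) there exists x₀ ∈ ℝ^n with pairwise distinct entries, T ∈ ℕ, and an update sequence i_1, …, i_T such that the trajectory of the weighted-median opinion dynamics started from x(0) = x₀ along this sequence is a consensus vector at time T; (3) there exists a vector y ∈ {-1,0,1}^n with y_i = 0 for exactly one index i and y_j ∈ {-1,1} for all j ≠ i, T ∈ ℕ, and an update sequence i_1, …, i_T such that the trajectory started from y(0) = y along this sequence satisfies y(T) = 0 (the all-zeros vector). -/

import Mathlib

open Finset MeasureTheory

/-- `m` is a weighted median of `x` associated with the weights `w`. -/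
def IsWMedian {V : Type*} [Fintype V] (x w : V → ℝ) (m : ℝ) : Prop :=
  (∃ i, x i = m) ∧
    (∑ i ∈ Finset.univ.filter (fun i => x i < m), w i) ≤ 1 / 2 ∧
    (∑ i ∈ Finset.univ.filter (fun i => m < x i), w i) ≤ 1 / 2

/-- `W` is a row-stochastic matrix. -/
def RowStochastic {V : Type*} [Fintype V] (W : V → V → ℝ) : Prop :=
  (∀ i j, 0 ≤ W i j) ∧ ∀ i, ∑ j, W i j = 1

open Classical in
/-- `Med W x i` : the weighted median of `x` w.r.t. the weights of row `i` of `W`;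
if it is not unique, the weighted median closest to `x i`. -/
noncomputable def Med {V : Type*} [Fintype V] (W : V → V → ℝ) (x : V → ℝ) (i : V) : ℝ :=
  if h : ∃ m, IsWMedian x (W i) m ∧ ∀ m', IsWMedian x (W i) m' → |m - x i| ≤ |m' - x i| then
    h.choose
  else x i

/-- Trajectory of the weighted-median opinion dynamics: at step `t → t+1` the node `u t`
updates its opinion to its weighted median, all other opinions stay unchanged. -/
noncomputable def traj {V : Type*} [Fintype V] [DecidableEq V]
    (W : V → V → ℝ) (u : ℕ → V) (x0 : V → ℝ) : ℕ → V → ℝ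
  | 0 => x0
  | t + 1 => Function.update (traj W u x0 t) (u t) (Med W (traj W u x0 t) (u t))

def IsEquilibrium {V : Type*} [Fintype V] (W : V → V → ℝ) (x : V → ℝ) : Prop :=
  ∀ i, Med W x i = x i

/-- `M` is a cohesive set. -/
def Cohesive {V : Type*} [Fintype V] (W : V → V → ℝ) (M : Finset V) : Prop :=
  ∀ i ∈ M, 1 / 2 ≤ ∑ j ∈ M, W i j

/-- `M` is a maximal cohesive set. -/
def MaxCohesive {V : Type*} [Fintype V] (W : V → V → ℝ) (M : Finset V) : Prop :=
  Cohesive W M ∧ ∀ i ∉ M, ¬ (1 / 2 < ∑ j ∈ M, W i j)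

/-- One step of the cohesive-expansion process: add one node `i` outside the current
set whose total weight on the current set exceeds 1/2. -/
def ExpStep {V : Type*} [Fintype V] [DecidableEq V] (W : V → V → ℝ) (A B : Finset V) : Prop :=
  ∃ i ∉ A, 1 / 2 < ∑ j ∈ A, W i j ∧ B = insert i A

/-- `E` is a cohesive expansion of `M`: obtained from `M` by repeatedly adding nodes,
until no further node can be added. -/
def IsExpansion {V : Type*} [Fintype V] [DecidableEq V] (W : V → V → ℝ) (M E : Finset V) : Prop :=
  Relation.ReflTransGen (ExpStep W) M E ∧ ∀ i ∉ E, ¬ (1 / 2 < ∑ j ∈ E, W i j)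

/-- `(i,j)` is a decisive out-link of `i`. -/
def Decisive {V : Type*} [Fintype V] [DecidableEq V] (W : V → V → ℝ) (i j : V) : Prop :=
  ∃ θ : Finset V, (∀ k ∈ θ, W i k ≠ 0) ∧ j ∈ θ ∧
    1 / 2 < ∑ k ∈ θ, W i k ∧ (∑ k ∈ θ.erase j, W i k) < 1 / 2

/-- `μ` is the law of the i.i.d. uniform random update sequence, characterized via its
finite-dimensional cylinder probabilities. -/
def IIDUniform {n : ℕ} (μ : Measure (ℕ → Fin n)) : Prop :=
  IsProbabilityMeasure μ ∧
    ∀ (s : Finset ℕ) (g : ℕ → Fin n),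
      μ {u | ∀ t ∈ s, u t = g t} = (1 / (n : ENNReal)) ^ s.card

/-- If some entry of `x` lies below `m`, the largest such entry `x j` splits the total weight
exactly as the threshold `m` does. -/
lemma exists_pred_entry {V : Type*} [Fintype V] {x w : V → ℝ} (hs : ∑ j, w j = 1)
    {m : ℝ} {k : V} (hk : x k < m) :
    ∃ j, x k ≤ x j ∧ x j < m ∧
      ∑ i ∈ univ.filter (fun i => x j < x i), w i
        = 1 - ∑ i ∈ univ.filter (fun i => x i < m), w i := by
  obtain ⟨j, hj, hmax⟩ := (univ.filter (fun i => x i < m)).exists_max_image x ⟨k, by simpa⟩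
  simp only [mem_filter, mem_univ, true_and] at hj hmax
  refine ⟨j, hmax k hk, hj, ?_⟩
  rw [← hs, ← sum_filter_add_sum_filter_not univ (fun i => x i < m), add_sub_cancel_left]
  congr 1
  ext i
  simp only [mem_filter, mem_univ, true_and]
  exact ⟨fun h h' => absurd (hmax i h') (not_le.2 h), fun h => hj.trans_le (not_lt.1 h)⟩

/-- If some entry of `x` lies above `m`, the smallest such entry `x j` splits the total weight
exactly as the threshold `m` does. -/
lemma exists_succ_entry {V : Type*} [Fintype V] {x w : V → ℝ} (hs : ∑ j, w j = 1)
    {m : ℝ} {k : V} (hk : m < x k) :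
    ∃ j, x j ≤ x k ∧ m < x j ∧
      ∑ i ∈ univ.filter (fun i => x i < x j), w i
        = 1 - ∑ i ∈ univ.filter (fun i => m < x i), w i := by
  simpa using exists_pred_entry (x := fun i => - x i) (m := -m) (k := k) hs (by simpa)

lemma exists_isWMedian {V : Type*} [Fintype V] [Nonempty V] {x w : V → ℝ}
    (hs : ∑ j, w j = 1) : ∃ m, IsWMedian x w m := by
  obtain ⟨M, -, hM⟩ := univ.exists_max_image x (univ_nonempty (α := V))
  obtain ⟨k, hk, hmin⟩ := (univ.filter (fun k =>
    ∑ i ∈ univ.filter (fun i => x k < x i), w i ≤ 1 / 2)).exists_min_image x ⟨M, by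
      simp only [mem_filter, mem_univ, true_and]
      rw [filter_false_of_mem fun i hi => not_lt.2 (hM i hi)]
      norm_num⟩
  simp only [mem_filter, mem_univ, true_and] at hk hmin
  refine ⟨x k, ⟨k, rfl⟩, ?_, hk⟩
  by_contra! h
  obtain ⟨l, hl⟩ : ∃ l, x l < x k := by
    by_contra! h'
    rw [filter_false_of_mem fun i _ => not_lt.2 (h' i)] at h
    norm_num at h
  obtain ⟨j, -, hj, he⟩ := exists_pred_entry hs hl
  exact absurd (hmin j (by linarith)) (not_le.2 hj)

/-- `m` is the weighted median of `x` for `w` nearest to `a`, expressed through weights: the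
weight strictly below (above) `m` is less than `1 / 2` whenever `a` lies below (above) `m`. -/
def IsNearestMedian {V : Type*} [Fintype V] (x w : V → ℝ) (a m : ℝ) : Prop :=
  IsWMedian x w m ∧
    (a < m → ∑ i ∈ univ.filter (fun i => x i < m), w i < 1 / 2) ∧
    (m < a → ∑ i ∈ univ.filter (fun i => m < x i), w i < 1 / 2)

lemma IsNearestMedian.le {V : Type*} [Fintype V] {x w : V → ℝ} (h0 : ∀ j, 0 ≤ w j)
    (hs : ∑ j, w j = 1) {a m m' : ℝ} (h : IsNearestMedian x w a m)
    (h' : IsNearestMedian x w a m') : m' ≤ m := by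
  by_contra! hlt
  have hcover : 1 ≤ ∑ i ∈ univ.filter (fun i => m < x i), w i
      + ∑ i ∈ univ.filter (fun i => x i < m'), w i := by
    rw [← hs, ← sum_filter_add_sum_filter_not univ (fun i => m < x i)]
    gcongr with i hi
    · exact fun i _ _ => h0 i
    · exact fun hi => (not_lt.1 hi).trans_lt hlt
  have h1 := h.1.2.2
  have h2 := h'.1.2.1
  rcases lt_or_ge a m' with ha | ha
  · linarith [h'.2.1 ha]
  · linarith [h.2.2 (hlt.trans_le ha)]

lemma IsNearestMedian.comp_monotone {V : Type*} [Fintype V] {x w : V → ℝ}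
    (h0 : ∀ j, 0 ≤ w j) {a m : ℝ} (h : IsNearestMedian x w a m) {f : ℝ → ℝ}
    (hf : Monotone f) : IsNearestMedian (f ∘ x) w (f a) (f m) := by
  have hlow : ∑ i ∈ univ.filter (fun i => (f ∘ x) i < f m), w i
      ≤ ∑ i ∈ univ.filter (fun i => x i < m), w i :=
    sum_le_sum_of_subset_of_nonneg
      (monotone_filter_right _ fun _ _ hi => hf.reflect_lt hi) fun i _ _ => h0 i
  have hupp : ∑ i ∈ univ.filter (fun i => f m < (f ∘ x) i), w i
      ≤ ∑ i ∈ univ.filter (fun i => m < x i), w i :=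
    sum_le_sum_of_subset_of_nonneg
      (monotone_filter_right _ fun _ _ hi => hf.reflect_lt hi) fun i _ _ => h0 i
  obtain ⟨⟨⟨k, hk⟩, h1, h2⟩, h3, h4⟩ := h
  exact ⟨⟨⟨k, congrArg f hk⟩, hlow.trans h1, hupp.trans h2⟩,
    fun h => hlow.trans_lt (h3 (hf.reflect_lt h)), fun h => hupp.trans_lt (h4 (hf.reflect_lt h))⟩

lemma isNearestMedian_of_closest {V : Type*} [Fintype V] {x w : V → ℝ}
    (h0 : ∀ j, 0 ≤ w j) (hs : ∑ j, w j = 1) {k : V} {m : ℝ} (hm : IsWMedian x w m)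
    (hc : ∀ m', IsWMedian x w m' → |m - x k| ≤ |m' - x k|) :
    IsNearestMedian x w (x k) m := by
  refine ⟨hm, fun hlt => ?_, fun hlt => ?_⟩
  · by_contra! hge
    obtain ⟨j, hkj, hj, he⟩ := exists_pred_entry hs hlt
    have hsub : ∑ i ∈ univ.filter (fun i => x i < x j), w i
        ≤ ∑ i ∈ univ.filter (fun i => x i < m), w i :=
      sum_le_sum_of_subset_of_nonneg
        (monotone_filter_right _ fun _ _ hi => lt_trans hi hj) fun i _ _ => h0 i
    have := hc (x j) ⟨⟨j, rfl⟩, hsub.trans hm.2.1, by linarith⟩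
    rw [abs_of_nonneg (by linarith), abs_of_nonneg (by linarith)] at this
    linarith
  · by_contra! hge
    obtain ⟨j, hkj, hj, he⟩ := exists_succ_entry hs hlt
    have hsub : ∑ i ∈ univ.filter (fun i => x j < x i), w i
        ≤ ∑ i ∈ univ.filter (fun i => m < x i), w i :=
      sum_le_sum_of_subset_of_nonneg
        (monotone_filter_right _ fun _ _ hi => lt_trans hj hi) fun i _ _ => h0 i
    have := hc (x j) ⟨⟨j, rfl⟩, by linarith, hsub.trans hm.2.2⟩
    rw [abs_of_nonpos (by linarith), abs_of_nonpos (by linarith)] at this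
    linarith

lemma isNearestMedian_Med {V : Type*} [Fintype V] {W : V → V → ℝ} (hW : RowStochastic W)
    (x : V → ℝ) (i : V) : IsNearestMedian x (W i) (x i) (Med W x i) := by
  have : Nonempty V := ⟨i⟩
  have hex : ∃ m, IsWMedian x (W i) m ∧
      ∀ m', IsWMedian x (W i) m' → |m - x i| ≤ |m' - x i| :=
    Set.exists_min_image {m | IsWMedian x (W i) m} (fun m => |m - x i|)
      ((Set.finite_range x).subset fun m hm => hm.1) (exists_isWMedian (hW.2 i))
  rw [Med, dif_pos hex]
  exact isNearestMedian_of_closest (hW.1 i) (hW.2 i) hex.choose_spec.1 hex.choose_spec.2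

/-- Weighted medians commute with nondecreasing maps. -/
lemma Med_comp_monotone {V : Type*} [Fintype V] {W : V → V → ℝ} (hW : RowStochastic W)
    {f : ℝ → ℝ} (hf : Monotone f) (x : V → ℝ) (i : V) :
    Med W (f ∘ x) i = f (Med W x i) := by
  have h1 := isNearestMedian_Med hW (f ∘ x) i
  have h2 := (isNearestMedian_Med hW x i).comp_monotone (hW.1 i) hf
  exact le_antisymm (h2.le (hW.1 i) (hW.2 i) h1) (h1.le (hW.1 i) (hW.2 i) h2)

/-- Trajectories commute with nondecreasing maps. -/
lemma traj_comp_monotone {V : Type*} [Fintype V] [DecidableEq V] {W : V → V → ℝ}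
    (hW : RowStochastic W) {f : ℝ → ℝ} (hf : Monotone f) (u : ℕ → V) (x : V → ℝ) (t : ℕ) :
    traj W u (f ∘ x) t = f ∘ traj W u x t := by
  induction t with
  | zero => rfl
  | succ t ih => rw [traj, traj, ih, Med_comp_monotone hW hf, Function.comp_update]

/-- Every opinion along a trajectory is one of the initial opinions. -/
lemma traj_mem_range {V : Type*} [Fintype V] [DecidableEq V] {W : V → V → ℝ}
    (hW : RowStochastic W) (u : ℕ → V) (x : V → ℝ) (t : ℕ) (i : V) :
    traj W u x t i ∈ Set.range x := by
  induction t generalizing i with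
  | zero => exact ⟨i, rfl⟩
  | succ t ih =>
    rw [traj]
    rcases eq_or_ne i (u t) with rfl | h
    · rw [Function.update_self]
      obtain ⟨k, hk⟩ := (isNearestMedian_Med hW (traj W u x t) (u t)).1.1
      exact hk ▸ ih k
    · rw [Function.update_of_ne h]
      exact ih i

/-- The sign as a map between reals. -/
noncomputable def realSign (x : ℝ) : ℝ := (SignType.sign x : ℝ)

lemma realSign_monotone : Monotone realSign := fun a b h => by
  have h' : SignType.sign a ≤ SignType.sign b := SignType.sign.monotone h
  unfold realSign
  revert h'
  cases SignType.sign a <;> cases SignType.sign b <;> simp +decide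

lemma realSign_eq_zero {x : ℝ} : realSign x = 0 ↔ x = 0 := by
  refine ⟨fun h => ?_, fun h => by simp [realSign, h]⟩
  by_contra hx
  rcases lt_or_gt_of_ne hx with hx | hx <;> norm_num [realSign, hx] at h

lemma realSign_of_ne_zero {x : ℝ} (hx : x ≠ 0) : realSign x = -1 ∨ realSign x = 1 := by
  rcases hx.lt_or_gt with h | h <;> simp [realSign, h]

/-- reaching consensus from some initial state with pairwise distinct entries
is equivalent to reaching the all-zeros vector from some ternary initial state with exactly
one zero entry and all other entries in `{-1, 1}`. -/
theorem distinct_consensus_iff_ternary_zero_consensus (n : ℕ) (hn : 0 < n)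
    (W : Fin n → Fin n → ℝ) (hW : RowStochastic W) :
    (∃ x0 : Fin n → ℝ, Function.Injective x0 ∧
        ∃ (T : ℕ) (u : ℕ → Fin n), ∀ i j, traj W u x0 T i = traj W u x0 T j) ↔
      (∃ y : Fin n → ℝ,
        (∃ i : Fin n, y i = 0 ∧ ∀ j, j ≠ i → (y j = -1 ∨ y j = 1)) ∧
        ∃ (T : ℕ) (u : ℕ → Fin n), ∀ j, traj W u y T j = 0) := by
  constructor
  · rintro ⟨x, hx, T, u, hT⟩
    obtain ⟨k, hk⟩ := traj_mem_range hW u x T ⟨0, hn⟩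
    have hf : Monotone fun z => realSign (z - x k) :=
      realSign_monotone.comp fun a b h => sub_le_sub_right h _
    refine ⟨(fun z => realSign (z - x k)) ∘ x, ⟨k, ?_, fun j hj => ?_⟩, T, u, fun j => ?_⟩
    · simp [realSign_eq_zero]
    · exact realSign_of_ne_zero (sub_ne_zero.2 (hx.ne hj))
    · rw [traj_comp_monotone hW hf, Function.comp_apply, realSign_eq_zero, hk, hT j, sub_self]
  · rintro ⟨y, ⟨i, hi, hy⟩, T, u, hT⟩
    have hval : ∀ j, y j = -1 ∨ y j = 1 ∨ (y j = 0 ∧ j = i) := fun j => by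
      rcases eq_or_ne j i with rfl | h
      · exact Or.inr (Or.inr ⟨hi, rfl⟩)
      · rcases hy j h with h | h <;> simp [h]
    have hpos : ∀ j : Fin n, (0 : ℝ) < (j : ℕ) + 1 := fun j => by positivity
    set x : Fin n → ℝ := fun j => y j * ((j : ℕ) + 1) with hx
    have hsign : realSign ∘ x = y := by
      funext j
      rcases hval j with h | h | ⟨h, -⟩ <;>
        simp only [hx, Function.comp_apply, realSign, sign_mul, sign_pos (hpos j), h] <;> simp
    refine ⟨x, fun j k hjk => ?_, T, u, ?_⟩
    · have hyjk : y j = y k := by rw [← hsign, Function.comp_apply, hjk, Function.comp_apply]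
      simp only [hx, hyjk] at hjk
      rcases eq_or_ne (y k) 0 with h0 | h0
      · have hzero : ∀ l, y l = 0 → l = i := fun l hl => by
          rcases hval l with h | h | h
          · norm_num [hl] at h
          · norm_num [hl] at h
          · exact h.2
        rw [hzero j (hyjk.trans h0), hzero k h0]
      · exact Fin.ext (by exact_mod_cast add_right_cancel (mul_left_cancel₀ h0 hjk))
    · have hzero : ∀ j, traj W u x T j = 0 := fun j => by
        rw [← realSign_eq_zero, ← hT j, ← hsign, traj_comp_monotone hW realSign_monotone,
          Function.comp_apply]
      intro j k
      rw [hzero j, hzero k]
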